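/- Let Y ⊆ ℓ₁ be a closed subspace of finite codimension d ∈ ℕ, and let q : ℓ₁ → ℓ₁/Y be the quotient map. Let ‖·‖ be an equivalent norm on ℓ₁/Y and let A ⊆ ℓ₁/Y be a symmetric (A = −A) convex F_σ set satisfying U_{(ℓ₁/Y,‖·‖)} ⊆ A ⊆ B_{(ℓ₁/Y,‖·‖)}. Then there is an equivalent norm |‖·‖| on ℓ₁ such that q(B_{(ℓ₁,|‖·‖|)}) = A. -/

import Mathlib

/-- `N` is a norm on `X` equivalent to the given norm `‖·‖`: it is subadditive, absolutely
homogeneous, and bounded above and below by positive multiples of `‖·‖`. -/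
def IsEquivNorm {X : Type*} [SeminormedAddCommGroup X] [NormedSpace ℝ X] (N : X → ℝ) : Prop :=
  (∀ x y : X, N (x + y) ≤ N x + N y) ∧
  (∀ (c : ℝ) (x : X), N (c • x) = |c| * N x) ∧
  ∃ c C : ℝ, 0 < c ∧ ∀ x : X, c * ‖x‖ ≤ N x ∧ N x ≤ C * ‖x‖

open Filter Topology

lemma aux_sigma_convex {ι E : Type*} [NormedAddCommGroup E] [NormedSpace ℝ E]
    [FiniteDimensional ℝ E] {A : Set E} (hA : Convex ℝ A) {a : ι → E} (ha : ∀ i, a i ∈ A)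
    {l : ι → ℝ} (hl : ∀ i, 0 < l i) (hl1 : HasSum l 1) {z : E}
    (hz : HasSum (fun i => l i • a i) z) : z ∈ A := by
  classical
  set b : ι → E := fun i => a i - z with hb
  have hb0 : HasSum (fun i => l i • b i) 0 := by
    have := hz.sub (hl1.smul_const z)
    simpa [hb, smul_sub] using this
  obtain ⟨s', hs', hspan⟩ := (Submodule.fg_span_iff_fg_span_finset_subset (R := ℝ)
    (Set.range b)).1 (IsNoetherian.noetherian _)
  obtain ⟨S, hS⟩ : ∃ S : Finset ι, S.image b = s' := by
    rw [← Set.image_univ] at hs'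
    obtain ⟨S, -, h⟩ := Finset.subset_set_image_iff.1 hs'
    exact ⟨S, h⟩
  let φ : (S → ℝ) →ₗ[ℝ] E := Fintype.linearCombination ℝ (fun i : S => b i)
  have hφ : LinearMap.range φ = Submodule.span ℝ (Set.range b) := by
    rw [Fintype.range_linearCombination, hspan, ← hS]
    congr 1
    ext x; simp
  obtain ⟨g, hg⟩ := φ.rangeRestrict.exists_rightInverse_of_surjective φ.range_rangeRestrict
  have hgc : Continuous g := g.continuous_of_finiteDimensional
  have hmem : ∀ T : Finset ι, ∑ i ∈ T, l i • b i ∈ LinearMap.range φ := by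
    intro T
    rw [hφ]
    exact Submodule.sum_mem _ fun i _ => Submodule.smul_mem _ _ (Submodule.subset_span ⟨i, rfl⟩)
  have ht : Tendsto (fun T : Finset ι => (⟨∑ i ∈ T, l i • b i, hmem T⟩ : LinearMap.range φ))
      atTop (𝓝 0) := by
    rw [tendsto_subtype_rng]
    exact hb0
  have ht2 := (hgc.tendsto 0).comp ht
  rw [map_zero, tendsto_pi_nhds] at ht2
  have hev : ∀ᶠ T : Finset ι in atTop, ∀ i : S,
      g ⟨∑ i ∈ T, l i • b i, hmem T⟩ i < l i := by
    rw [eventually_all]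
    intro i
    exact (ht2 i).eventually_lt_const (hl i)
  have hne : Nonempty ι := by
    by_contra h
    rw [not_nonempty_iff] at h
    exact zero_ne_one (hasSum_empty.unique hl1)
  obtain ⟨i0⟩ := hne
  obtain ⟨T, hT, hTS⟩ := (hev.and (eventually_ge_atTop (insert i0 S))).exists
  set c : S → ℝ := g ⟨∑ i ∈ T, l i • b i, hmem T⟩ with hc
  have hcφ : φ c = ∑ i ∈ T, l i • b i := by
    have := LinearMap.congr_fun hg ⟨∑ i ∈ T, l i • b i, hmem T⟩
    exact congrArg Subtype.val this
  let c' : ι → ℝ := fun i => if h : i ∈ S then c ⟨i, h⟩ else 0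
  have hST : S ⊆ T := (Finset.subset_insert _ _).trans hTS
  have hc' : ∑ i ∈ T, c' i • b i = ∑ i ∈ T, l i • b i := by
    rw [← hcφ, Fintype.linearCombination_apply]
    rw [← Finset.sum_subset hST (by intro i _ hi; simp [c', hi]), ← Finset.sum_coe_sort S]
    refine Finset.sum_congr rfl fun i _ => ?_
    simp [c']
  have hpos : ∀ i, 0 < l i - c' i := by
    intro i
    by_cases h : i ∈ S
    · simp only [c', h, dif_pos]; linarith [hT ⟨i, h⟩]
    · simp only [c', h, dif_neg, not_false_eq_true]; linarith [hl i]
  have hTne : T.Nonempty := ⟨i0, hTS (Finset.mem_insert_self _ _)⟩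
  have hsum : 0 < ∑ i ∈ T, (l i - c' i) := Finset.sum_pos (fun i _ => hpos i) hTne
  have hfin := hA.centerMass_mem (t := T) (w := fun i => l i - c' i) (z := a)
    (fun i _ => (hpos i).le) hsum (fun i _ => ha i)
  have h0 : ∑ i ∈ T, (l i - c' i) • b i = 0 := by
    simp only [sub_smul, Finset.sum_sub_distrib, hc', sub_self]
  have h1 : ∑ i ∈ T, (l i - c' i) • a i = (∑ i ∈ T, (l i - c' i)) • z := by
    rw [Finset.sum_smul, ← sub_eq_zero, ← Finset.sum_sub_distrib, ← h0]
    exact Finset.sum_congr rfl fun i _ => by simp [hb, smul_sub]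
  rw [Finset.centerMass, h1, smul_smul, inv_mul_cancel₀ hsum.ne', one_smul] at hfin
  exact hfin

lemma aux_sigma_convex' {E : Type*} [NormedAddCommGroup E] [NormedSpace ℝ E]
    [FiniteDimensional ℝ E] {A : Set E} (hA : Convex ℝ A) (h0 : (0 : E) ∈ A) {a : ℕ → E}
    {l : ℕ → ℝ} (ha : ∀ i, 0 < l i → (l i)⁻¹ • a i ∈ A) (ha0 : ∀ i, l i = 0 → a i = 0)
    (hl : ∀ i, 0 ≤ l i) {s : ℝ} (hls : HasSum l s) (hs1 : s ≤ 1) {z : E}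
    (hz : HasSum a z) : z ∈ A := by
  by_cases hall : ∀ i, l i = 0
  · have : a = fun _ => 0 := funext fun i => ha0 i (hall i)
    rw [this] at hz
    rwa [hz.unique hasSum_zero]
  push Not at hall
  obtain ⟨i0, hi0⟩ := hall
  have hs : 0 < s := lt_of_lt_of_le (lt_of_le_of_ne (hl i0) hi0.symm) (le_hasSum hls i0 fun i _ => hl i)
  let P : Set ℕ := {i | 0 < l i}
  have hP0 : ∀ i, i ∉ P → l i = 0 := fun i hi => le_antisymm (not_lt.1 hi) (hl i)
  have h1 : HasSum (fun i : P => l i / s) 1 := by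
    have : HasSum (fun i => l i / s) 1 := by
      have := hls.div_const s
      rwa [div_self hs.ne'] at this
    exact (hasSum_subtype_iff_of_support_subset (s := P) (f := fun i => l i / s) (by
      intro i hi
      by_contra h
      exact hi (by simp [hP0 i h]))).2 this
  have h2 : HasSum (fun i : P => (l i / s) • ((l i)⁻¹ • a i)) (s⁻¹ • z) := by
    have : HasSum (fun i : P => s⁻¹ • a i) (s⁻¹ • z) :=
      (hasSum_subtype_iff_of_support_subset (s := P) (f := fun i => s⁻¹ • a i) (by
      intro i hi
      by_contra h
      exact hi (by simp [ha0 i (hP0 i h)]))).2 (hz.const_smul s⁻¹)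
    convert this using 2 with i
    have : (l i) ≠ 0 := ne_of_gt i.2
    rw [smul_smul]
    congr 1
    field_simp
  have h3 := aux_sigma_convex hA (fun i : P => ha i i.2) (fun i => div_pos i.2 hs) h1 h2
  have := hA.smul_mem_of_zero_mem h0 h3 ⟨hs.le, hs1⟩
  rwa [smul_smul, mul_inv_cancel₀ hs.ne', one_smul] at this

lemma aux_compact_hull {E : Type*} [NormedAddCommGroup E] [NormedSpace ℝ E]
    [FiniteDimensional ℝ E] {K : Set E} (hK : IsCompact K) : IsCompact (convexHull ℝ K) := by
  have : convexHull ℝ K = ⋃ m ∈ Finset.range (Module.finrank ℝ E + 2),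
      (fun p : (Fin m → ℝ) × (Fin m → E) => ∑ i, p.1 i • p.2 i) ''
        (stdSimplex ℝ (Fin m) ×ˢ Set.univ.pi fun _ => K) := by
    ext x
    simp only [Set.mem_iUnion, Set.mem_image, Set.mem_prod, Set.mem_pi, Set.mem_univ,
      forall_true_left, exists_prop, Finset.mem_range, Prod.exists]
    constructor
    · intro hx
      obtain ⟨ι, _, z, w, hz, haff, hw, hw1, hx⟩ := eq_pos_convex_span_of_mem_convexHull hx
      have hcard := haff.card_le_finrank_succ
      have : Module.finrank ℝ (vectorSpan ℝ (Set.range z)) ≤ Module.finrank ℝ E :=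
        Submodule.finrank_le _
      let e := Fintype.equivFin ι
      refine ⟨Fintype.card ι, by omega, w ∘ e.symm, z ∘ e.symm, ⟨⟨fun i => (hw _).le, ?_⟩,
        fun i => hz ⟨_, rfl⟩⟩, ?_⟩
      · rw [← hw1]; exact e.symm.sum_comp w
      · rw [← hx]; exact e.symm.sum_comp (fun i => w i • z i)
    · rintro ⟨m, _, w, z, ⟨hw, hz⟩, rfl⟩
      exact (convex_convexHull ℝ K).sum_mem (fun i _ => hw.1 i) hw.2
        (fun i _ => subset_convexHull ℝ K (hz i))
  rw [this]
  refine Finset.isCompact_biUnion _ fun m _ => ?_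
  refine ((isCompact_stdSimplex ℝ (Fin m)).prod (isCompact_univ_pi fun _ => hK)).image ?_
  fun_prop

lemma aux_norms {E : Type*} [NormedAddCommGroup E] [NormedSpace ℝ E]
    [FiniteDimensional ℝ E] {A : Set E} (hA : Convex ℝ A) (hsymm : ∀ u ∈ A, -u ∈ A)
    {r R : ℝ} (hr : 0 < r) (hR : 0 < R) (hrA : Metric.ball 0 r ⊆ A)
    (hRA : A ⊆ Metric.closedBall 0 R) {F : ℕ → Set E} (hF : ∀ n, IsClosed (F n))
    (hAF : A = ⋃ n, F n) :
    ∃ p : ℕ → E → ℝ, (∀ n u v, p n (u + v) ≤ p n u + p n v) ∧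
      (∀ n (c : ℝ) u, p n (c • u) = |c| * p n u) ∧
      (∀ n u, R⁻¹ * ‖u‖ ≤ p n u) ∧ (∀ n u, p n u ≤ (r / 2)⁻¹ * ‖u‖) ∧
      (∀ n u, p n u ≤ 1 → u ∈ A) ∧ (∀ u ∈ A, ∃ n, p n u ≤ 1) := by
  let G : ℕ → Set E := fun n => F n ∪ (-F n) ∪ Metric.closedBall 0 (r / 2)
  have hFA : ∀ n, F n ⊆ A := fun n => hAF ▸ Set.subset_iUnion F n
  have hGA : ∀ n, G n ⊆ A := by
    rintro n u ((h | h) | h)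
    · exact hFA n h
    · have := hsymm _ (hFA n (Set.mem_neg.1 h)); rwa [neg_neg] at this
    · exact hrA (Metric.closedBall_subset_ball (by linarith) h)
  have hFc : ∀ n, IsCompact (F n) := fun n =>
    (isCompact_closedBall (0 : E) R).of_isClosed_subset (hF n) ((hFA n).trans hRA)
  have hGc : ∀ n, IsCompact (G n) := fun n =>
    ((hFc n).union (hFc n).neg).union (isCompact_closedBall _ _)
  let K : ℕ → Set E := fun n => convexHull ℝ (G n)
  have hKc : ∀ n, IsCompact (K n) := fun n => aux_compact_hull (hGc n)
  have hKA : ∀ n, K n ⊆ A := fun n => convexHull_min (hGA n) hA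
  have hKconv : ∀ n, Convex ℝ (K n) := fun n => convex_convexHull ℝ _
  have hGK : ∀ n, G n ⊆ K n := fun n => subset_convexHull ℝ _
  have hKb : ∀ n, Metric.ball 0 (r / 2) ⊆ K n := fun n =>
    (Metric.ball_subset_closedBall.trans Set.subset_union_right).trans (hGK n)
  have hKn : ∀ n, K n ∈ 𝓝 (0 : E) := fun n =>
    Filter.mem_of_superset (Metric.ball_mem_nhds _ (by positivity)) (hKb n)
  have hKabs : ∀ n, Absorbent ℝ (K n) := fun n => absorbent_nhds_zero (hKn n)
  have hGneg : ∀ n, -G n = G n := by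
    intro n
    simp only [G, Set.union_neg, neg_neg, neg_closedBall, neg_zero, Set.union_comm (-F n)]
  have hKneg : ∀ n, ∀ u ∈ K n, -u ∈ K n := by
    intro n u hu
    have : -K n = K n := by
      simp only [K]
      rw [← convexHull_neg, hGneg]
    rw [← this] at hu
    exact hu
  refine ⟨fun n => gauge (K n), fun n u v => gauge_add_le (hKconv n) (hKabs n) u v, ?_, ?_, ?_,
    ?_, ?_⟩
  · intro n c u
    show gauge (K n) (c • u) = |c| * gauge (K n) u
    rcases le_total 0 c with hc | hc
    · rw [gauge_smul_of_nonneg hc, abs_of_nonneg hc, smul_eq_mul]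
    · rw [abs_of_nonpos hc, ← smul_eq_mul, ← gauge_smul_of_nonneg (by linarith : 0 ≤ -c), neg_smul,
        gauge_neg (hKneg n)]
  · intro n u
    have := le_gauge_of_subset_closedBall (x := u) (hKabs n) hR.le ((hKA n).trans hRA)
    rwa [div_eq_inv_mul] at this
  · intro n u
    have := mul_gauge_le_norm (x := u) (hKb n)
    rw [← div_eq_inv_mul, le_div_iff₀ (by positivity)]
    linarith
  · intro n u hu
    have := (gauge_le_one_iff_mem_closure (hKconv n) (hKn n)).1 hu
    rw [(hKc n).isClosed.closure_eq] at this
    exact hKA n this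
  · intro u hu
    rw [hAF] at hu
    obtain ⟨n, hn⟩ := Set.mem_iUnion.1 hu
    exact ⟨n, gauge_le_one_of_mem (hGK n (Or.inl (Or.inl hn)))⟩

lemma aux_shear {X Q : Type*} [NormedAddCommGroup X] [NormedSpace ℝ X]
    [NormedAddCommGroup Q] [NormedSpace ℝ Q] [FiniteDimensional ℝ Q]
    (q s : X →L[ℝ] Q) (hq : Function.Surjective q) (hs : Function.Surjective s) :
    ∃ T T' : X →L[ℝ] X, (∀ x, T (T' x) = x) ∧ (∀ x, T' (T x) = x) ∧ ∀ x, s (T x) = q x := by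
  obtain ⟨r1, hr1⟩ := (q : X →ₗ[ℝ] Q).exists_rightInverse_of_surjective
    (LinearMap.range_eq_top.2 hq)
  obtain ⟨r2, hr2⟩ := (s : X →ₗ[ℝ] Q).exists_rightInverse_of_surjective
    (LinearMap.range_eq_top.2 hs)
  let f1 : Module.End ℝ Q := (s : X →ₗ[ℝ] Q) ∘ₗ r1
  let f2 : Module.End ℝ Q := (q : X →ₗ[ℝ] Q) ∘ₗ r2
  have hfin1 : Set.Finite {t : ℝ | f1.HasEigenvalue (-t)} :=
    f1.finite_hasEigenvalue.preimage (neg_injective.injOn)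
  have hfin2 : Set.Finite {t : ℝ | f2.HasEigenvalue (-t⁻¹)} :=
    f2.finite_hasEigenvalue.preimage ((neg_injective.comp inv_injective).injOn)
  obtain ⟨t, ht⟩ := ((hfin1.union hfin2).union (Set.finite_singleton 0)).infinite_compl.nonempty
  simp only [Set.mem_compl_iff, Set.mem_union, Set.mem_ofPred_eq, Set.mem_singleton_iff, not_or] at ht
  obtain ⟨⟨h1, h2⟩, h0⟩ := ht
  let r : Q →ₗ[ℝ] X := r1 + t • r2
  have hqr1 : ∀ u, q (r1 u) = u := fun u => LinearMap.congr_fun hr1 u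
  have hsr2 : ∀ u, s (r2 u) = u := fun u => LinearMap.congr_fun hr2 u
  have hA : Function.Injective ((q : X →ₗ[ℝ] Q) ∘ₗ r) := by
    rw [injective_iff_map_eq_zero]
    intro u hu
    by_contra hne
    apply h2
    refine Module.End.hasEigenvalue_of_hasEigenvector (x := u) ⟨?_, hne⟩
    rw [Module.End.mem_eigenspace_iff]
    have : u + t • q (r2 u) = 0 := by simpa [r, hqr1] using hu
    have h3 : t • q (r2 u) = -u := (neg_eq_of_add_eq_zero_right this).symm
    have : q (r2 u) = t⁻¹ • (t • q (r2 u)) := by rw [smul_smul, inv_mul_cancel₀ h0, one_smul]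
    rw [h3] at this
    simpa [f2] using this
  have hB : Function.Injective ((s : X →ₗ[ℝ] Q) ∘ₗ r) := by
    rw [injective_iff_map_eq_zero]
    intro u hu
    by_contra hne
    apply h1
    refine Module.End.hasEigenvalue_of_hasEigenvector (x := u) ⟨?_, hne⟩
    rw [Module.End.mem_eigenspace_iff]
    have : s (r1 u) + t • u = 0 := by simpa [r, hsr2] using hu
    simpa [f1] using eq_neg_of_add_eq_zero_left this
  let eq := LinearEquiv.ofInjectiveEndo _ hA
  let es := LinearEquiv.ofInjectiveEndo _ hB
  have heq : ∀ u, q (r (eq.symm u)) = u := fun u => eq.apply_symm_apply u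
  have hes : ∀ u, s (r (es.symm u)) = u := fun u => es.apply_symm_apply u
  have heq' : ∀ u, eq.symm (q (r u)) = u := fun u => eq.symm_apply_apply u
  have hes' : ∀ u, es.symm (s (r u)) = u := fun u => es.symm_apply_apply u
  let ρq : Q →L[ℝ] X := LinearMap.toContinuousLinearMap (r ∘ₗ (eq.symm : Q →ₗ[ℝ] Q))
  let ρs : Q →L[ℝ] X := LinearMap.toContinuousLinearMap (r ∘ₗ (es.symm : Q →ₗ[ℝ] Q))
  have hρq : ∀ u, ρq u = r (eq.symm u) := fun u => rfl
  have hρs : ∀ u, ρs u = r (es.symm u) := fun u => rfl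
  refine ⟨ContinuousLinearMap.id ℝ X + ρs.comp (q - s), ContinuousLinearMap.id ℝ X + ρq.comp (s - q),
    ?_, ?_, ?_⟩
  · intro x
    simp only [_root_.add_apply, ContinuousLinearMap.id_apply,
      ContinuousLinearMap.comp_apply, _root_.sub_apply, map_add, map_sub, hρq, hρs,
      heq, hes, heq', hes']
    abel
  · intro x
    simp only [_root_.add_apply, ContinuousLinearMap.id_apply,
      ContinuousLinearMap.comp_apply, _root_.sub_apply, map_add, map_sub, hρq, hρs,
      heq, hes, heq', hes']
    abel
  · intro x
    simp only [_root_.add_apply, ContinuousLinearMap.id_apply,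
      ContinuousLinearMap.comp_apply, _root_.sub_apply, map_add, map_sub, hρs, hes]
    abel

lemma aux_block {Q : Type*} [NormedAddCommGroup Q] [NormedSpace ℝ Q] [FiniteDimensional ℝ Q]
    [Nontrivial Q] {A : Set Q} (hA : Convex ℝ A) (h0 : (0 : Q) ∈ A) {p : ℕ → Q → ℝ}
    (hadd : ∀ n u v, p n (u + v) ≤ p n u + p n v)
    (hsmul : ∀ n (c : ℝ) u, p n (c • u) = |c| * p n u) {c1 C1 : ℝ} (hc1 : 0 < c1) (hC1 : 0 < C1)
    (hlow : ∀ n u, c1 * ‖u‖ ≤ p n u) (hup : ∀ n u, p n u ≤ C1 * ‖u‖)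
    (hin : ∀ n u, p n u ≤ 1 → u ∈ A) (hex : ∀ u ∈ A, ∃ n, p n u ≤ 1) :
    ∃ (s : lp (fun _ : ℕ => ℝ) 1 →L[ℝ] Q) (N : lp (fun _ : ℕ => ℝ) 1 → ℝ),
      Function.Surjective s ∧ IsEquivNorm N ∧ s '' {x | N x ≤ 1} = A := by
  classical
  let d := Module.finrank ℝ Q
  have hd : 0 < d := Module.finrank_pos
  haveI : Nonempty (Fin d) := ⟨⟨0, hd⟩⟩
  let v : Module.Basis (Fin d) ℝ Q := Module.finBasis ℝ Q
  obtain ⟨e⟩ : Nonempty (ℕ × Fin d ≃ ℕ) := by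
    haveI : Denumerable (ℕ × Fin d) := Denumerable.ofEncodableOfInfinite _
    exact ⟨Denumerable.eqv _⟩
  let X := lp (fun _ : ℕ => ℝ) 1
  have h1 : ∀ x : X, HasSum (fun i => |x i|) ‖x‖ := by
    intro x
    have := lp.hasSum_norm (p := 1) (by norm_num) x
    simpa using this
  let b : ℕ → X → Q := fun n x => ∑ i, x (e (n, i)) • v i
  let β : ℕ → X → ℝ := fun n x => ∑ i, |x (e (n, i))|
  have hbadd : ∀ n x y, b n (x + y) = b n x + b n y := by
    intro n x y; simp [b, add_smul, Finset.sum_add_distrib]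
  have hbsmul : ∀ n (c : ℝ) x, b n (c • x) = c • b n x := by
    intro n c x
    simp only [b, Finset.smul_sum]
    refine Finset.sum_congr rfl fun i _ => ?_
    rw [smul_smul]
    rfl
  have hβ : ∀ x, HasSum (fun n => β n x) ‖x‖ := fun x =>
    (e.hasSum_iff.2 (h1 x)).prod_fiberwise fun n => hasSum_fintype _
  obtain ⟨Cw, hCw, hbβ⟩ : ∃ C : ℝ, 0 < C ∧ ∀ n x, ‖b n x‖ ≤ C * β n x := by
    refine ⟨∑ i, ‖v i‖, Finset.sum_pos (fun i _ => norm_pos_iff.2 (v.ne_zero i))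
      Finset.univ_nonempty, fun n x => ?_⟩
    refine (norm_sum_le _ _).trans ?_
    rw [Finset.mul_sum]
    refine Finset.sum_le_sum fun i _ => ?_
    rw [norm_smul, mul_comm, Real.norm_eq_abs]
    exact mul_le_mul_of_nonneg_right
      (Finset.single_le_sum (f := fun i => ‖v i‖) (fun i _ => norm_nonneg _) (Finset.mem_univ i))
      (abs_nonneg _)
  obtain ⟨D, hD, hβb⟩ : ∃ D : ℝ, 0 < D ∧ ∀ n x, β n x ≤ D * ‖b n x‖ := by
    let L : Q →L[ℝ] (Fin d → ℝ) := LinearMap.toContinuousLinearMap (v.equivFun : Q →ₗ[ℝ] (Fin d → ℝ))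
    refine ⟨d * ‖L‖ + 1, by positivity, fun n x => ?_⟩
    have hL : L (b n x) = fun i => x (e (n, i)) := by
      have : b n x = v.equivFun.symm (fun i => x (e (n, i))) := (v.equivFun_symm_apply _).symm
      rw [this]
      exact v.equivFun.apply_symm_apply _
    have h2 : ∀ i, |x (e (n, i))| ≤ ‖L‖ * ‖b n x‖ := by
      intro i
      have h3 := norm_le_pi_norm (L (b n x)) i
      have h4 : L (b n x) i = x (e (n, i)) := congrFun hL i
      rw [h4, Real.norm_eq_abs] at h3
      exact h3.trans (L.le_opNorm _)
    calc β n x ≤ ∑ _i : Fin d, ‖L‖ * ‖b n x‖ := Finset.sum_le_sum fun i _ => h2 i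
      _ = d * ‖L‖ * ‖b n x‖ := by simp [mul_assoc]
      _ ≤ (d * ‖L‖ + 1) * ‖b n x‖ := by gcongr; linarith
  have hbsum : ∀ x, Summable (fun n => ‖b n x‖) := fun x =>
    Summable.of_nonneg_of_le (fun _ => norm_nonneg _) (fun n => hbβ n x) ((hβ x).summable.mul_left Cw)
  have hbs : ∀ x, Summable (fun n => b n x) := fun x => (hbsum x).of_norm
  have hp0 : ∀ n u, 0 ≤ p n u := fun n u => le_trans (by positivity) (hlow n u)
  have hpz : ∀ n, p n 0 = 0 := fun n => by simpa using hsmul n 0 0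
  have hps : ∀ x, Summable (fun n => p n (b n x)) := fun x =>
    Summable.of_nonneg_of_le (fun _ => hp0 _ _) (fun n => hup n _) ((hbsum x).mul_left C1)
  let s0 : X →ₗ[ℝ] Q :=
    { toFun := fun x => ∑' n, b n x
      map_add' := fun x y => by
        simp only [hbadd]; exact (hbs x).tsum_add (hbs y)
      map_smul' := fun c x => by
        simp only [hbsmul, RingHom.id_apply]; exact (hbs x).tsum_const_smul c }
  let s : X →L[ℝ] Q := s0.mkContinuous Cw fun x => by
    calc ‖s0 x‖ ≤ ∑' n, ‖b n x‖ := norm_tsum_le_tsum_norm (hbsum x)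
      _ ≤ ∑' n, Cw * β n x := (hbsum x).tsum_le_tsum (fun n => hbβ n x)
          ((hβ x).summable.mul_left Cw)
      _ = Cw * ‖x‖ := ((hβ x).mul_left Cw).tsum_eq
  have hs : ∀ x, s x = ∑' n, b n x := fun x => rfl
  -- placing a vector in block `n`
  have hput : ∀ n u, ∃ x : X, b n x = u ∧ ∀ m, m ≠ n → b m x = 0 := by
    intro n u
    refine ⟨∑ i, lp.single 1 (e (n, i)) (v.repr u i), ?_, ?_⟩
    · have : ∀ j, (∑ i, lp.single 1 (e (n, i)) (v.repr u i) : X) (e (n, j)) = v.repr u j := by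
        intro j
        rw [lp.coeFn_sum, Finset.sum_apply, Finset.sum_eq_single j]
        · simp
        · intro i _ hij
          rw [lp.single_apply_ne]
          simpa using hij.symm
        · simp
      simp only [b, this]
      exact v.sum_repr u
    · intro m hm
      have : ∀ j, (∑ i, lp.single 1 (e (n, i)) (v.repr u i) : X) (e (m, j)) = 0 := by
        intro j
        rw [lp.coeFn_sum, Finset.sum_apply]
        refine Finset.sum_eq_zero fun i _ => ?_
        rw [lp.single_apply_ne]
        simp [hm]
      simp only [b, this, zero_smul, Finset.sum_const_zero]
  refine ⟨s, fun x => ∑' n, p n (b n x), ?_, ⟨?_, ?_, c1 * D⁻¹, C1 * Cw, by positivity, ?_⟩, ?_⟩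
  · intro u
    obtain ⟨x, hx, hx'⟩ := hput 0 u
    exact ⟨x, by rw [hs, tsum_eq_single 0 hx', hx]⟩
  · intro x y
    show ∑' n, p n (b n (x + y)) ≤ ∑' n, p n (b n x) + ∑' n, p n (b n y)
    rw [← (hps x).tsum_add (hps y)]
    refine (hps _).tsum_le_tsum (fun n => ?_) ((hps x).add (hps y))
    rw [hbadd]; exact hadd _ _ _
  · intro c x
    show ∑' n, p n (b n (c • x)) = |c| * ∑' n, p n (b n x)
    simp only [hbsmul, hsmul]
    exact tsum_mul_left
  · intro x
    constructor
    · rw [← ((hβ x).mul_left (c1 * D⁻¹)).tsum_eq]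
      refine ((hβ x).summable.mul_left _).tsum_le_tsum (fun n => ?_) (hps x)
      refine le_trans ?_ (hlow n _)
      rw [mul_assoc]
      refine mul_le_mul_of_nonneg_left ?_ hc1.le
      rw [inv_mul_le_iff₀ hD]
      exact hβb n x
    · rw [← ((hβ x).mul_left (C1 * Cw)).tsum_eq]
      refine (hps x).tsum_le_tsum (fun n => ?_) ((hβ x).summable.mul_left _)
      refine (hup n _).trans ?_
      rw [mul_assoc]
      exact mul_le_mul_of_nonneg_left (hbβ n x) hC1.le
  · ext u
    constructor
    · rintro ⟨x, hx, rfl⟩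
      refine aux_sigma_convex' hA h0 (a := fun n => b n x) (l := fun n => p n (b n x)) ?_ ?_
        (fun n => hp0 _ _) (hps x).hasSum hx (hbs x).hasSum
      · intro n hn
        refine hin n _ ?_
        rw [hsmul, abs_of_pos (inv_pos.2 hn), inv_mul_cancel₀ hn.ne']
      · intro n hn
        have := hlow n (b n x)
        rw [show p n (b n x) = 0 from hn] at this
        have h3 : ‖b n x‖ ≤ 0 := by
          by_contra h
          push Not at h
          have := mul_pos hc1 h
          linarith
        exact norm_le_zero_iff.1 h3
    · intro hu
      obtain ⟨n, hn⟩ := hex u hu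
      obtain ⟨x, hx, hx'⟩ := hput n u
      refine ⟨x, ?_, by rw [hs, tsum_eq_single n hx', hx]⟩
      show ∑' m, p m (b m x) ≤ 1
      rw [tsum_eq_single n (fun m hm => by rw [hx' m hm, hpz]), hx]
      exact hn

lemma aux_final {Q : Type*} [NormedAddCommGroup Q] [NormedSpace ℝ Q] [FiniteDimensional ℝ Q]
    (q : lp (fun _ : ℕ => ℝ) 1 →L[ℝ] Q) (hq : Function.Surjective q)
    (M : Q → ℝ) (hM : IsEquivNorm M)
    (A : Set Q) (hsymm : ∀ u ∈ A, -u ∈ A) (hconv : Convex ℝ A)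
    (hFsigma : ∃ F : ℕ → Set Q, (∀ n, IsClosed (F n)) ∧ A = ⋃ n, F n)
    (hU : {u : Q | M u < 1} ⊆ A) (hB : A ⊆ {u : Q | M u ≤ 1}) :
    ∃ N : lp (fun _ : ℕ => ℝ) 1 → ℝ, IsEquivNorm N ∧ q '' {x | N x ≤ 1} = A := by
  obtain ⟨-, -, c, C, hc, hcC⟩ := hM
  obtain ⟨F, hF, hAF⟩ := hFsigma
  have h0 : (0 : Q) ∈ A := hU (by
    have := (hcC 0).2
    simp only [norm_zero, mul_zero] at this
    exact lt_of_le_of_lt this one_pos)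
  rcases subsingleton_or_nontrivial Q with hQ | hQ
  · refine ⟨fun x => ‖x‖, ⟨norm_add_le, fun c x => (norm_smul c x).trans (by rw [Real.norm_eq_abs]), 1, 1,
      one_pos, fun x => by simp⟩, ?_⟩
    ext u
    constructor
    · intro _; rwa [Subsingleton.elim u 0]
    · intro _; exact ⟨0, by simp, Subsingleton.elim _ _⟩
  have hr : 0 < (|C| + 1)⁻¹ := by positivity
  obtain ⟨p, h1, h2, h3, h4, h5, h6⟩ := aux_norms hconv hsymm hr (inv_pos.2 hc) (by
      intro u hu
      apply hU
      rw [mem_ball_zero_iff] at hu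
      have h := (hcC u).2
      have h2 : (|C| + 1) * ‖u‖ < 1 := by
        rwa [← lt_inv_mul_iff₀ (by positivity), mul_one]
      have h3 : C * ‖u‖ ≤ (|C| + 1) * ‖u‖ :=
        mul_le_mul_of_nonneg_right (by linarith [le_abs_self C]) (norm_nonneg _)
      exact lt_of_le_of_lt (h.trans h3) h2) (by
      intro u hu
      rw [mem_closedBall_zero_iff]
      have h : M u ≤ 1 := hB hu
      rw [← mul_one c⁻¹, le_inv_mul_iff₀ hc]
      exact (hcC u).1.trans h) hF hAF
  obtain ⟨s, N, hs, ⟨hN1, hN2, k, K, hk, hkK⟩, hsN⟩ := aux_block hconv h0 h1 h2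
    (by positivity) (by positivity) h3 h4 h5 h6
  obtain ⟨T, T', hTT', hT'T, hsT⟩ := aux_shear q s hq hs
  refine ⟨fun x => N (T x), ⟨fun x y => ?_, fun c x => ?_, k * (‖T'‖ + 1)⁻¹, |K| * ‖T‖,
    by positivity, fun x => ⟨?_, ?_⟩⟩, ?_⟩
  · simp only [map_add]; exact hN1 _ _
  · simp only [map_smul]; exact hN2 _ _
  · refine le_trans ?_ (hkK (T x)).1
    rw [mul_assoc]
    refine mul_le_mul_of_nonneg_left ?_ hk.le
    rw [inv_mul_le_iff₀ (by positivity)]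
    have := T'.le_opNorm (T x)
    rw [hT'T] at this
    linarith [norm_nonneg (T x)]
  · refine (hkK (T x)).2.trans ?_
    rw [mul_assoc]
    refine (mul_le_mul_of_nonneg_right (le_abs_self K) (norm_nonneg _)).trans ?_
    exact mul_le_mul_of_nonneg_left (T.le_opNorm x) (abs_nonneg _)
  · rw [← hsN]
    ext u
    constructor
    · rintro ⟨x, hx, rfl⟩
      exact ⟨T x, hx, hsT x⟩
    · rintro ⟨x, hx, rfl⟩
      refine ⟨T' x, ?_, ?_⟩
      · show N (T (T' x)) ≤ 1
        rw [hTT']; exact hx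
      · rw [← hsT, hTT']

/-- Let `Y ⊆ ℓ₁` be a closed subspace of finite codimension `d`,
`q : ℓ₁ → ℓ₁ ⧸ Y` the quotient map, `M` an equivalent norm on `ℓ₁ ⧸ Y` and `A ⊆ ℓ₁ ⧸ Y` a
symmetric convex `F_σ` set with `U_M ⊆ A ⊆ B_M`.  Then `ℓ₁` admits an equivalent norm `N`
such that `q` maps the `N`-closed unit ball exactly onto `A`. -/
theorem stmt15 (d : ℕ) (Y : Submodule ℝ (lp (fun _ : ℕ => ℝ) 1))
    [IsClosed (Y : Set (lp (fun _ : ℕ => ℝ) 1))]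
    [FiniteDimensional ℝ (lp (fun _ : ℕ => ℝ) 1 ⧸ Y)]
    (hd : Module.finrank ℝ (lp (fun _ : ℕ => ℝ) 1 ⧸ Y) = d)
    (M : (lp (fun _ : ℕ => ℝ) 1 ⧸ Y) → ℝ) (hM : IsEquivNorm M)
    (A : Set (lp (fun _ : ℕ => ℝ) 1 ⧸ Y))
    (hsymm : ∀ u ∈ A, -u ∈ A) (hconv : Convex ℝ A)
    (hFsigma : ∃ F : ℕ → Set (lp (fun _ : ℕ => ℝ) 1 ⧸ Y),
      (∀ n, IsClosed (F n)) ∧ A = ⋃ n, F n)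
    (hU : {u : lp (fun _ : ℕ => ℝ) 1 ⧸ Y | M u < 1} ⊆ A)
    (hB : A ⊆ {u : lp (fun _ : ℕ => ℝ) 1 ⧸ Y | M u ≤ 1}) :
    ∃ N : lp (fun _ : ℕ => ℝ) 1 → ℝ, IsEquivNorm N ∧
      (Submodule.Quotient.mk (p := Y)) '' {x : lp (fun _ : ℕ => ℝ) 1 | N x ≤ 1} = A := by
  exact aux_final (Q := lp (fun _ : ℕ => ℝ) 1 ⧸ Y) Y.mkQL (Submodule.Quotient.mk_surjective Y)
    M hM A hsymm hconv hFsigma hU hB
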